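/- There exist absolute constants c > 0 and C ≥ 1 such that for all integers k ≥ 2 and n, U ≥ C·k: any length-n ROBP over alphabet [U] that computes HeavyHitters[n,U,k] has width at least max{(n/k)^{c·k}, (U/k)^{c·k}}. (Equivalently, solving HeavyHitters[n,U,k] requires Ω(k(log(n/k) + log(U/k))) bits of space in the streaming model.) -/

import Mathlib

open Finset

/-- A length-`n` read-once branching program over alphabet `σ` with outputs in `Out`.
Layer `t` has vertex set `Fin (size t)` (only layers `0, 1, …, n` are relevant);
layer `0` consists of a single start vertex, and each vertex of layer `t` has an
outgoing edge to layer `t+1` for every letter of the alphabet. -/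
structure ROBP (σ Out : Type) (n : ℕ) where
  size : ℕ → ℕ
  size0 : size 0 = 1
  sizePos : ∀ t, 0 < size t
  step : (t : ℕ) → Fin (size t) → σ → Fin (size (t + 1))
  out : Fin (size n) → Out

namespace ROBP

variable {σ Out : Type} {n : ℕ}

/-- The vertex reached in layer `t` on input `x` (only `x 0, …, x (t-1)` matter). -/
def state (P : ROBP σ Out n) (x : ℕ → σ) : (t : ℕ) → Fin (P.size t)
  | 0 => ⟨0, P.sizePos 0⟩
  | t + 1 => P.step t (state P x t) (x t)

/-- The width of an ROBP: the maximal number of vertices in a single layer. -/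
def width (P : ROBP σ Out n) : ℕ := (Finset.range (n + 1)).sup P.size

/-- Every vertex (in the relevant layers) is reached by some input: no useless vertices. -/
def Reachable (P : ROBP σ Out n) : Prop :=
  ∀ t, t ≤ n → ∀ v : Fin (P.size t), ∃ x : ℕ → σ, P.state x t = v

/-- The output of the program on input `x`. -/
def eval (P : ROBP σ Out n) (x : ℕ → σ) : Out := P.out (P.state x n)

end ROBP

/-- The number of occurrences of `j` among `x 0, …, x (t-1)`. -/
def countK {k : ℕ} (x : ℕ → Fin k) (t : ℕ) (j : Fin k) : ℕ :=
  ((Finset.range t).filter fun i => x i = j).card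

/-- `P` computes `ApproxCount_k[n, Δ]`: on every input, each of the `k` outputs estimates
the frequency of the corresponding letter within additive error `Δ`. -/
def ComputesApproxCountK (k n : ℕ) (Δ : ℝ) (P : ROBP (Fin k) (Fin k → ℝ) n) : Prop :=
  ∀ x : ℕ → Fin k, ∀ j : Fin k, |P.eval x j - (countK x n j : ℝ)| ≤ Δ

/-- `P` computes `ApproxCount[n, Δ]` (the `{0,1}` case). -/
def ComputesApproxCount (n : ℕ) (Δ : ℝ) (P : ROBP Bool ℝ n) : Prop :=
  ∀ x : ℕ → Bool, |P.eval x - (((Finset.range n).filter fun i => x i = true).card : ℝ)| ≤ Δ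

/-- The number of `1`'s in coordinate `j` among `x 0, …, x (t-1)`. -/
def countPar {k : ℕ} (x : ℕ → (Fin k → Bool)) (t : ℕ) (j : Fin k) : ℕ :=
  ((Finset.range t).filter fun i => x i j = true).card

/-- `P` computes `ApproxCount^par_k[n, Δ]`. -/
def ComputesApproxCountPar (k n : ℕ) (Δ : ℝ) (P : ROBP (Fin k → Bool) (Fin k → ℝ) n) : Prop :=
  ∀ x : ℕ → (Fin k → Bool), ∀ j : Fin k, |P.eval x j - (countPar x n j : ℝ)| ≤ Δ

/-- The inclusion `[k-1] ⊆ [k]`. -/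
def idx {k : ℕ} (j : Fin (k - 1)) : Fin k := Fin.castLE (Nat.sub_le k 1) j

/-- `a_j(v)`: the minimal possible number of `j`'s in the first `t` input words
reaching the vertex `v` of layer `t`. -/
noncomputable def rectLo {k n : ℕ} (P : ROBP (Fin k) (Fin k → ℝ) n) (t : ℕ)
    (v : Fin (P.size t)) (j : Fin (k - 1)) : ℕ :=
  sInf {c | ∃ x : ℕ → Fin k, P.state x t = v ∧ countK x t (idx j) = c}

/-- `b_j(v)`: the maximal possible number of `j`'s in the first `t` input words
reaching the vertex `v` of layer `t`. -/
noncomputable def rectHi {k n : ℕ} (P : ROBP (Fin k) (Fin k → ℝ) n) (t : ℕ)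
    (v : Fin (P.size t)) (j : Fin (k - 1)) : ℕ :=
  sSup {c | ∃ x : ℕ → Fin k, P.state x t = v ∧ countK x t (idx j) = c}

/-- `a_j(v)` for the `k`-parallel case. -/
noncomputable def parLo {k n : ℕ} (P : ROBP (Fin k → Bool) (Fin k → ℝ) n) (t : ℕ)
    (v : Fin (P.size t)) (j : Fin k) : ℕ :=
  sInf {c | ∃ x : ℕ → (Fin k → Bool), P.state x t = v ∧ countPar x t j = c}

/-- `b_j(v)` for the `k`-parallel case. -/
noncomputable def parHi {k n : ℕ} (P : ROBP (Fin k → Bool) (Fin k → ℝ) n) (t : ℕ)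
    (v : Fin (P.size t)) (j : Fin k) : ℕ :=
  sSup {c | ∃ x : ℕ → (Fin k → Bool), P.state x t = v ∧ countPar x t j = c}

/-- The axis-parallel box `[lo 1, hi 1] × ⋯ × [lo m, hi m]` (as a set of integer points). -/
def rect {m : ℕ} (lo hi : Fin m → ℕ) : Set (Fin m → ℕ) :=
  {y | ∀ j, lo j ≤ y j ∧ y j ≤ hi j}

/-- The potential `φ_t(x)` of the point `x` (k-counter case): the maximum, over all
rectangle labels of layer `t` containing `x`, of `min{Σ_j b_j, t} - Σ_j x_j`. -/
noncomputable def phiK {k n : ℕ} (P : ROBP (Fin k) (Fin k → ℝ) n) (t : ℕ)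
    (x : Fin (k - 1) → ℕ) : ℕ :=
  Finset.univ.sup fun v : Fin (P.size t) =>
    if ∀ j, rectLo P t v j ≤ x j ∧ x j ≤ rectHi P t v j then
      min (∑ j, rectHi P t v j) t - ∑ j, x j
    else 0

/-- `T_{t,k}`: tuples of naturals summing to at most `t`. -/
def Tset (k t : ℕ) : Finset (Fin (k - 1) → ℕ) :=
  (Fintype.piFinset fun _ => Finset.range (t + 1)).filter fun x => ∑ j, x j ≤ t

/-- The total potential `Φ_t` of layer `t` (k-counter case). -/
noncomputable def PhiK {k n : ℕ} (P : ROBP (Fin k) (Fin k → ℝ) n) (t : ℕ) : ℕ :=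
  ∑ x ∈ Tset k t, phiK P t x

/-- The potential `φ_t(x)` of the point `x` (k-parallel case). -/
noncomputable def phiPar {k n : ℕ} (P : ROBP (Fin k → Bool) (Fin k → ℝ) n) (t : ℕ)
    (x : Fin k → ℕ) : ℕ :=
  Finset.univ.sup fun v : Fin (P.size t) =>
    if ∀ j, parLo P t v j ≤ x j ∧ x j ≤ parHi P t v j then
      (∑ j, parHi P t v j) - ∑ j, x j
    else 0

/-- The total potential `Φ_t` of layer `t` (k-parallel case): the sum of `φ_t(x)`
over `x ∈ {0, 1, …, ⌊n/10⌋}^k`. -/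
noncomputable def PhiPar {k n : ℕ} (P : ROBP (Fin k → Bool) (Fin k → ℝ) n) (t : ℕ) : ℕ :=
  ∑ x ∈ Fintype.piFinset (fun _ : Fin k => Finset.range (n / 10 + 1)), phiPar P t x

/-- The generalized binomial coefficient `C(x, m) = x (x-1) ⋯ (x-m+1) / m!`. -/
noncomputable def genChoose (x : ℝ) (m : ℕ) : ℝ :=
  (∏ i ∈ Finset.range m, (x - (i : ℝ))) / (Nat.factorial m : ℝ)

/-- The frequency of `a` among `x 0, …, x (n-1)`. -/
def freqU {U : ℕ} (x : ℕ → Fin U) (n : ℕ) (a : Fin U) : ℕ :=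
  ((Finset.range n).filter fun i => x i = a).card

/-- `P` computes `HeavyHitters[n,U,k]`: on every input `x ∈ [U]^n`, `P` outputs a list
`u_1, …, u_k ∈ [U]` containing every element of frequency at least `n/k`, together with
estimates `f̃_i` with `f_i - n/k ≤ f̃_i ≤ f_i`, where `f_i` is the frequency of `u_i`. -/
def ComputesHeavyHitters (n U k : ℕ)
    (P : ROBP (Fin U) ((Fin k → Fin U) × (Fin k → ℝ)) n) : Prop :=
  ∀ x : ℕ → Fin U,
    (∀ a : Fin U, (n : ℝ) / (k : ℝ) ≤ (freqU x n a : ℝ) → ∃ i : Fin k, (P.eval x).1 i = a) ∧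
    (∀ i : Fin k,
      (freqU x n ((P.eval x).1 i) : ℝ) - (n : ℝ) / (k : ℝ) ≤ (P.eval x).2 i ∧
      (P.eval x).2 i ≤ (freqU x n ((P.eval x).1 i) : ℝ))

namespace ROBP

variable {σ Out : Type} {n : ℕ}

theorem state_congr (P : ROBP σ Out n) {x y : ℕ → σ} :
    ∀ {t : ℕ}, (∀ i < t, x i = y i) → P.state x t = P.state y t
  | 0, _ => rfl
  | t + 1, h => by
    simp only [state]
    rw [P.state_congr fun i hi => h i (by omega), h t (by omega)]

theorem state_update_succ (P : ROBP σ Out n) [DecidableEq σ] (x : ℕ → σ) (t : ℕ) (a : σ) :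
    P.state (Function.update x t a) (t + 1) = P.step t (P.state x t) a := by
  simp only [state, Function.update_self]
  rw [P.state_congr fun i hi => Function.update_of_ne (by omega) _ _]

theorem size_le_width (P : ROBP σ Out n) {t : ℕ} (ht : t ≤ n) : P.size t ≤ P.width :=
  Finset.le_sup (f := P.size) (Finset.mem_range.2 (by omega))

end ROBP

section Words

variable {U : ℕ}

theorem freqU_update_succ (x : ℕ → Fin U) (t : ℕ) (a b : Fin U) :
    freqU (Function.update x t a) (t + 1) b = freqU x t b + if a = b then 1 else 0 := by
  have h : ∀ i ∈ Finset.range t, (Function.update x t a i = b ↔ x i = b) := fun i hi => by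
    rw [Function.update_of_ne (by simp at hi; omega)]
  unfold freqU
  rw [Finset.range_add_one, Finset.filter_insert, Function.update_self, Finset.filter_congr h]
  split_ifs <;> simp

/-- There is a word of length `t` with prescribed letter counts, up to padding by the letter `e`. -/
theorem exists_freqU_eq (e : Fin U) :
    ∀ (t : ℕ) (g : Fin U → ℕ), ∑ a ∈ Finset.univ.erase e, g a ≤ t →
      ∃ y : ℕ → Fin U, ∀ a, a ≠ e → freqU y t a = g a
  | 0, g, h => by
    refine ⟨fun _ => e, fun a ha => ?_⟩
    have h0 := Finset.sum_eq_zero_iff.1 (Nat.le_zero.1 h) a (by simpa using ha)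
    simp [freqU, h0]
  | t + 1, g, h => by
    by_cases hle : ∑ a ∈ Finset.univ.erase e, g a ≤ t
    · obtain ⟨y, hy⟩ := exists_freqU_eq e t g hle
      refine ⟨Function.update y t e, fun a ha => ?_⟩
      rw [freqU_update_succ, hy a ha, if_neg ha.symm, add_zero]
    · obtain ⟨c, hc, hgc⟩ : ∃ c ∈ Finset.univ.erase e, g c ≠ 0 := by
        by_contra! h0
        exact hle (by rw [Finset.sum_eq_zero h0]; omega)
      have hsum : ∑ a ∈ Finset.univ.erase e, Function.update g c (g c - 1) a ≤ t := by
        rw [Finset.sum_update_of_mem hc]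
        have := Finset.add_sum_erase _ g hc
        rw [Finset.sdiff_singleton_eq_erase]
        omega
      obtain ⟨y, hy⟩ := exists_freqU_eq e t _ hsum
      refine ⟨Function.update y t c, fun a ha => ?_⟩
      rw [freqU_update_succ, hy a ha]
      by_cases hac : c = a
      · subst hac
        simp only [Function.update_self, if_true]
        omega
      · rw [Function.update_of_ne (Ne.symm hac), if_neg hac, add_zero]

end Words

section Rectangles

variable {U n m : ℕ} {Out : Type}

/-- Some vertex of layer `t` has a rectangle of letter counts that contains the point `x` and
whose upper corner has coordinate sum at least `s`. -/
def CoveredUpTo (P : ROBP (Fin U) Out n) (ι : Fin m → Fin U) (t : ℕ) (x : Fin m → ℕ)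
    (s : ℕ) : Prop :=
  ∃ (v : Fin (P.size t)) (b : Fin m → ℕ),
    (∀ j, ∃ y, P.state y t = v ∧ freqU y t (ι j) ≤ x j) ∧
    (∀ j, ∃ y, P.state y t = v ∧ freqU y t (ι j) = b j) ∧ x ≤ b ∧ s ≤ ∑ j, b j

variable {P : ROBP (Fin U) Out n} {ι : Fin m → Fin U} {e : Fin U} {t : ℕ} {x : Fin m → ℕ}

theorem CoveredUpTo.succ {s : ℕ} (he : ∀ j, ι j ≠ e) (h : CoveredUpTo P ι t x s) :
    CoveredUpTo P ι (t + 1) x s := by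
  obtain ⟨v, b, ha, hb, hxb, hs⟩ := h
  refine ⟨P.step t v e, b, fun j => ?_, fun j => ?_, hxb, hs⟩
  · obtain ⟨y, rfl, hy⟩ := ha j
    refine ⟨Function.update y t e, P.state_update_succ y t e, ?_⟩
    rwa [freqU_update_succ, if_neg (he j).symm]
  · obtain ⟨y, rfl, hy⟩ := hb j
    refine ⟨Function.update y t e, P.state_update_succ y t e, ?_⟩
    rwa [freqU_update_succ, if_neg (he j).symm]

/-- Unless a point is the lower corner of its rectangle, the upper corner can be raised
in the next layer. -/
theorem coveredUpTo_succ_add_one (hι : Function.Injective ι) {v : Fin (P.size t)}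
    {b : Fin m → ℕ} {s : ℕ}
    (ha : ∀ j, ∃ y, P.state y t = v ∧ freqU y t (ι j) ≤ x j)
    (hb : ∀ j, ∃ y, P.state y t = v ∧ freqU y t (ι j) = b j) (hxb : x ≤ b)
    (hs : s ≤ ∑ j, b j) {j : Fin m}
    (hj : ∃ y, P.state y t = v ∧ freqU y t (ι j) < x j) :
    CoveredUpTo P ι (t + 1) x (s + 1) := by
  refine ⟨P.step t v (ι j), fun i => b i + if i = j then 1 else 0, fun i => ?_, fun i => ?_,
    fun i => (hxb i).trans (Nat.le_add_right _ _), ?_⟩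
  · by_cases hij : i = j
    · subst hij
      obtain ⟨y, rfl, hy⟩ := hj
      refine ⟨Function.update y t (ι i), P.state_update_succ y t _, ?_⟩
      rw [freqU_update_succ, if_pos rfl]
      exact hy
    · obtain ⟨y, rfl, hy⟩ := ha i
      refine ⟨Function.update y t (ι j), P.state_update_succ y t _, ?_⟩
      rwa [freqU_update_succ, if_neg fun h => hij (hι h).symm]
  · obtain ⟨y, rfl, hy⟩ := hb i
    refine ⟨Function.update y t (ι j), P.state_update_succ y t _, ?_⟩
    rw [freqU_update_succ, hy]
    simp [hι.eq_iff, eq_comm]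
  · rw [Finset.sum_add_distrib]
    simpa using hs

/-- Points that cannot be raised in the next layer are lower corners of distinct rectangles. -/
theorem card_le_size_of_not_coveredUpTo (hι : Function.Injective ι) {S : Finset (Fin m → ℕ)}
    {f : (Fin m → ℕ) → ℕ} (hf : ∀ x ∈ S, CoveredUpTo P ι t x (f x))
    (hf' : ∀ x ∈ S, ¬ CoveredUpTo P ι (t + 1) x (f x + 1)) : S.card ≤ P.size t := by
  have key : ∀ x ∈ S, ∃ v : Fin (P.size t), ∀ j,
      (∃ y, P.state y t = v ∧ freqU y t (ι j) = x j) ∧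
        ∀ y, P.state y t = v → x j ≤ freqU y t (ι j) := by
    intro x hx
    obtain ⟨v, b, ha, hb, hxb, hs⟩ := hf x hx
    have hmin : ∀ j y, P.state y t = v → x j ≤ freqU y t (ι j) := by
      intro j y hy
      by_contra! hlt
      exact hf' x hx (coveredUpTo_succ_add_one hι ha hb hxb hs ⟨y, hy, hlt⟩)
    refine ⟨v, fun j => ⟨?_, hmin j⟩⟩
    obtain ⟨y, hy, hle⟩ := ha j
    exact ⟨y, hy, le_antisymm hle (hmin j y hy)⟩
  have : Nonempty (Fin (P.size t)) := ⟨⟨0, P.sizePos t⟩⟩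
  choose! V hV using key
  have hinj : Set.InjOn V S := by
    intro x hx z hz hxz
    funext j
    obtain ⟨⟨y, hy, hyx⟩, hx'⟩ := hV x hx j
    obtain ⟨⟨y', hy', hyz⟩, hz'⟩ := hV z hz j
    rw [hxz] at hy hx'
    exact le_antisymm (hyz ▸ hx' y' hy') (hyx ▸ hz' y hy)
  simpa using Finset.card_le_card_of_injOn (t := Finset.univ) V (by simp) hinj

theorem exists_coveredUpTo_sum (hι : Function.Injective ι) (he : ∀ j, ι j ≠ e)
    (B : Finset (Fin m → ℕ)) {t₀ : ℕ} (hB : ∀ x ∈ B, ∑ j, x j ≤ t₀) :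
    ∀ d, t₀ + d ≤ n → ∃ f : (Fin m → ℕ) → ℕ,
      (∀ x ∈ B, CoveredUpTo P ι (t₀ + d) x (f x)) ∧
        d * B.card ≤ ∑ x ∈ B, f x + d * P.width := by
  classical
  intro d
  induction d with
  | zero =>
    refine fun _ => ⟨fun _ => 0, fun x hx => ?_, by simp⟩
    have hsum : ∑ a ∈ Finset.univ.erase e, Function.extend ι x 0 a ≤ t₀ := by
      refine le_trans ?_ (hB x hx)
      rw [← Finset.sum_subset (s₁ := Finset.univ.image ι)]
      · rw [Finset.sum_image hι.injOn]
        exact Finset.sum_le_sum fun j _ => (hι.extend_apply x 0 j).le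
      · intro a ha
        obtain ⟨j, -, rfl⟩ := Finset.mem_image.1 ha
        simpa using he j
      · intro a _ ha
        exact Function.extend_apply' _ _ _ fun ⟨j, hj⟩ => ha (by simp [← hj])
    obtain ⟨y, hy⟩ := exists_freqU_eq e t₀ _ hsum
    have hy' : ∀ j, freqU y t₀ (ι j) = x j := fun j => by rw [hy _ (he j), hι.extend_apply]
    exact ⟨P.state y t₀, x, fun j => ⟨y, rfl, (hy' j).le⟩, fun j => ⟨y, rfl, hy' j⟩, le_rfl,
      Nat.zero_le _⟩
  | succ d ih =>
    intro hd
    obtain ⟨f, hf, hsum⟩ := ih (by omega)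
    refine ⟨fun x => f x + if CoveredUpTo P ι (t₀ + d + 1) x (f x + 1) then 1 else 0,
      fun x hx => ?_, ?_⟩
    · dsimp only
      split_ifs with h
      · exact h
      · exact (hf x hx).succ he
    · have hcard := card_le_size_of_not_coveredUpTo (P := P) (t := t₀ + d) (f := f) hι
        (S := B.filter fun x => ¬ CoveredUpTo P ι (t₀ + d + 1) x (f x + 1))
        (fun x hx => hf x (Finset.mem_filter.1 hx).1) fun x hx => (Finset.mem_filter.1 hx).2
      have hw := P.size_le_width (t := t₀ + d) (by omega)
      have hsplit := Finset.card_filter_add_card_filter_not (s := B)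
        (fun x => CoveredUpTo P ι (t₀ + d + 1) x (f x + 1))
      rw [Finset.sum_add_distrib, ← Finset.card_filter]
      linarith

end Rectangles

section HeavyHitters

variable {n U k : ℕ} {P : ROBP (Fin U) ((Fin k → Fin U) × (Fin k → ℝ)) n}

theorem ComputesHeavyHitters.freqU_le_of_state_eq (h : ComputesHeavyHitters n U k P)
    {y z : ℕ → Fin U} (hyz : P.state y n = P.state z n) (a : Fin U) :
    (freqU z n a : ℝ) ≤ freqU y n a + (n : ℝ) / k := by
  have heval : P.eval y = P.eval z := by simp only [ROBP.eval, hyz]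
  by_cases ha : (n : ℝ) / k ≤ freqU z n a
  · obtain ⟨i, rfl⟩ := (h z).1 a ha
    have hz := ((h z).2 i).1
    have hy := ((h y).2 i).2
    rw [heval] at hy
    linarith
  · have : (0 : ℝ) ≤ freqU y n a := Nat.cast_nonneg _
    linarith

theorem ComputesHeavyHitters.mul_pow_le (h : ComputesHeavyHitters n U k P) {m N : ℕ}
    (hmU : m < U) (hmN : m * N ≤ n) :
    ((n : ℝ) - m * N) * (N : ℝ) ^ m ≤
      (N : ℝ) ^ m * (m * (N + (n : ℝ) / k)) + ((n : ℝ) - m * N) * P.width := by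
  classical
  let ι : Fin m → Fin U := Fin.castLE hmU.le
  have hι : Function.Injective ι := Fin.castLE_injective _
  have he : ∀ j, ι j ≠ ⟨m, hmU⟩ := fun j hj => by
    have := congrArg Fin.val hj
    simp [ι] at this
    omega
  let B : Finset (Fin m → ℕ) := Fintype.piFinset fun _ => Finset.range N
  have hlt : ∀ x ∈ B, ∀ j, x j ≤ N := fun x hx j => by
    have := Fintype.mem_piFinset.1 hx j
    simp at this
    omega
  have hBcard : B.card = N ^ m := by simp [B]
  have hB : ∀ x ∈ B, ∑ j, x j ≤ m * N := fun x hx => by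
    simpa using Finset.sum_le_sum fun j (_ : j ∈ Finset.univ) => hlt x hx j
  obtain ⟨f, hf, hsum⟩ :=
    exists_coveredUpTo_sum (P := P) hι he B hB (n - m * N) (by omega)
  rw [Nat.add_sub_cancel' hmN] at hf
  have hfx : ∀ x ∈ B, (f x : ℝ) ≤ m * (N + (n : ℝ) / k) := by
    intro x hx
    obtain ⟨v, b, ha, hb, -, hs⟩ := hf x hx
    have hbj : ∀ j, (b j : ℝ) ≤ N + (n : ℝ) / k := fun j => by
      obtain ⟨y, hy, hya⟩ := ha j
      obtain ⟨z, hz, hzb⟩ := hb j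
      have := h.freqU_le_of_state_eq (hy.trans hz.symm) (ι j)
      rw [hzb] at this
      have hyN : (freqU y n (ι j) : ℝ) ≤ N := by exact_mod_cast hya.trans (hlt x hx j)
      linarith
    calc (f x : ℝ) ≤ ∑ j, (b j : ℝ) := by exact_mod_cast hs
      _ ≤ ∑ _j : Fin m, ((N : ℝ) + (n : ℝ) / k) := Finset.sum_le_sum fun j _ => hbj j
      _ = _ := by simp [mul_add]
  have hfsum : ((∑ x ∈ B, f x : ℕ) : ℝ) ≤ (N : ℝ) ^ m * (m * (N + (n : ℝ) / k)) := by
    push_cast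
    refine (Finset.sum_le_sum hfx).trans_eq ?_
    rw [Finset.sum_const, hBcard, nsmul_eq_mul]
    push_cast
    ring
  have hreal : ((n - m * N : ℕ) : ℝ) * (B.card : ℝ) ≤
      ((∑ x ∈ B, f x : ℕ) : ℝ) + ((n - m * N : ℕ) : ℝ) * P.width := by exact_mod_cast hsum
  rw [hBcard, Nat.cast_sub hmN] at hreal
  push_cast at hreal hfsum
  linarith

theorem ComputesHeavyHitters.choose_le (h : ComputesHeavyHitters n U k P) (hk : 0 < k)
    {s : ℕ} (hsU : s < U) (hs : s * (n / k + 1) ≤ n) :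
    U.choose s ≤ P.width * k.choose s := by
  classical
  let L : Fin (P.size n) → Finset (Fin U) := fun v => Finset.univ.image (P.out v).1
  have hL : ∀ v, (L v).card ≤ k := fun v => Finset.card_image_le.trans (by simp)
  have hcover : Finset.powersetCard s (Finset.univ : Finset (Fin U)) ⊆
      Finset.univ.biUnion fun v => Finset.powersetCard s (L v) := by
    intro S hS
    have hScard := (Finset.mem_powersetCard.1 hS).2
    obtain ⟨e, he⟩ : ∃ e, e ∉ S := by
      by_contra! hall
      have : S = Finset.univ := Finset.eq_univ_iff_forall.2 hall
      rw [this, Finset.card_univ, Fintype.card_fin] at hScard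
      omega
    have hsum : ∑ a ∈ Finset.univ.erase e, (if a ∈ S then n / k + 1 else 0) ≤ n := by
      calc _ ≤ ∑ a, (if a ∈ S then n / k + 1 else 0) :=
            Finset.sum_le_sum_of_subset (Finset.erase_subset _ _)
        _ ≤ n := by simpa [hScard] using hs
    obtain ⟨y, hy⟩ := exists_freqU_eq e n _ hsum
    refine Finset.mem_biUnion.2 ⟨P.state y n, Finset.mem_univ _,
      Finset.mem_powersetCard.2 ⟨fun a ha => ?_, hScard⟩⟩
    have hya := hy a fun hae => he (hae ▸ ha)
    rw [if_pos ha] at hya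
    obtain ⟨i, hi⟩ := (h y).1 a (by
      rw [hya, div_le_iff₀ (by positivity)]
      exact_mod_cast (Nat.lt_div_mul_add hk (a := n)).le.trans_eq (by ring))
    exact Finset.mem_image.2 ⟨i, Finset.mem_univ _, hi⟩
  calc U.choose s = (Finset.powersetCard s (Finset.univ : Finset (Fin U))).card := by simp
    _ ≤ _ := Finset.card_le_card hcover
    _ ≤ (Finset.univ : Finset (Fin (P.size n))).card * k.choose s :=
        Finset.card_biUnion_le_card_mul _ _ _ fun v _ => by
          rw [Finset.card_powersetCard]
          exact Nat.choose_le_choose s (hL v)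
    _ ≤ P.width * k.choose s := by
        rw [Finset.card_univ, Fintype.card_fin]
        exact Nat.mul_le_mul_right _ (P.size_le_width le_rfl)

end HeavyHitters

theorem descFactorial_mul_pow_le {k U : ℕ} (h : k ≤ U) (s : ℕ) :
    k.descFactorial s * U ^ s ≤ U.descFactorial s * k ^ s := by
  induction s with
  | zero => simp
  | succ s ih =>
    have hstep : (k - s) * U ≤ (U - s) * k := by
      rw [Nat.sub_mul, Nat.sub_mul, Nat.mul_comm U k]
      exact Nat.sub_le_sub_left (Nat.mul_le_mul_left s h) _
    calc k.descFactorial (s + 1) * U ^ (s + 1)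
        = ((k - s) * U) * (k.descFactorial s * U ^ s) := by
          rw [Nat.descFactorial_succ]; ring
      _ ≤ ((U - s) * k) * (U.descFactorial s * k ^ s) := Nat.mul_le_mul hstep ih
      _ = _ := by rw [Nat.descFactorial_succ]; ring

theorem choose_mul_pow_le {k U : ℕ} (h : k ≤ U) (s : ℕ) :
    k.choose s * U ^ s ≤ U.choose s * k ^ s := by
  have := descFactorial_mul_pow_le h s
  rw [Nat.descFactorial_eq_factorial_mul_choose, Nat.descFactorial_eq_factorial_mul_choose,
    mul_assoc, mul_assoc] at this
  exact Nat.le_of_mul_le_mul_left this s.factorial_pos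

theorem ComputesHeavyHitters.alphabet_pow_le_width {n U k : ℕ}
    {P : ROBP (Fin U) ((Fin k → Fin U) × (Fin k → ℝ)) n} (h : ComputesHeavyHitters n U k P)
    (hk : 2 ≤ k) (hn : k ≤ n) (hU : k ≤ U) :
    ((U : ℝ) / k) ^ (k / 2) ≤ P.width := by
  have hs : k / 2 * (n / k + 1) ≤ n := by
    have h1 : k * (n / k) ≤ n := Nat.mul_div_le n k
    have h2 : k / 2 * 2 ≤ k := Nat.div_mul_le_self k 2
    nlinarith [Nat.mul_le_mul_right (n / k + 1) h2]
  have h1 := h.choose_le (by omega) (by omega : k / 2 < U) hs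
  have h2 := choose_mul_pow_le hU (k / 2)
  have h3 : U ^ (k / 2) ≤ P.width * k ^ (k / 2) := by
    refine Nat.le_of_mul_le_mul_left (c := k.choose (k / 2)) ?_
      (Nat.choose_pos (Nat.div_le_self k 2))
    calc _ ≤ _ := h2
      _ ≤ (P.width * k.choose (k / 2)) * k ^ (k / 2) := Nat.mul_le_mul_right _ h1
      _ = _ := by ring
  rw [div_pow, div_le_iff₀ (by positivity)]
  exact_mod_cast h3

theorem ComputesHeavyHitters.length_pow_le_width {n U k : ℕ}
    {P : ROBP (Fin U) ((Fin k → Fin U) × (Fin k → ℝ)) n} (h : ComputesHeavyHitters n U k P)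
    (hk : 2 ≤ k) (hn : 40 * k ≤ n) (hU : k ≤ U) :
    ((n : ℝ) / k / 160) ^ (k / 2) ≤ P.width := by
  set m := k / 2
  set N := n / (20 * k)
  have hk0 : (0 : ℝ) < k := by exact_mod_cast (by omega : 0 < k)
  have hm : m * 2 ≤ k := Nat.div_mul_le_self k 2
  have hN : 20 * k * N ≤ n := Nat.mul_div_le n _
  have hNlt : n < 20 * k * (N + 1) :=
    Nat.lt_mul_div_succ n (by omega : 0 < 20 * k)
  have hmN : 40 * (m * N) ≤ n := by nlinarith [Nat.mul_le_mul_right N hm]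
  have hmain := h.mul_pow_le (by omega : m < U) (by omega : m * N ≤ n)
  have hmN' : 40 * ((m : ℝ) * N) ≤ n := by exact_mod_cast hmN
  have hmn : (m : ℝ) * (n / k) ≤ n / 2 := by
    have : (m : ℝ) * 2 ≤ k := by exact_mod_cast hm
    rw [mul_div_assoc', div_le_iff₀ hk0]
    nlinarith [(Nat.cast_nonneg n : (0 : ℝ) ≤ n)]
  have hn0 : (0 : ℝ) < n := by exact_mod_cast (by omega : 0 < n)
  have hpow : (0 : ℝ) ≤ (N : ℝ) ^ m := by positivity
  have hw : (0 : ℝ) ≤ P.width := Nat.cast_nonneg _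
  have hquarter : (N : ℝ) ^ m / 4 ≤ P.width := by
    refine le_of_mul_le_mul_left ?_ hn0
    nlinarith [mul_le_mul_of_nonneg_left hmN' hpow, mul_le_mul_of_nonneg_left hmn hpow,
      mul_nonneg hn0.le hpow, mul_nonneg (by positivity : (0 : ℝ) ≤ (m : ℝ) * N) hw]
  have hNr : (n : ℝ) / k / 160 ≤ N / 4 := by
    have h1 : (n : ℝ) < 20 * k * (N + 1) := by exact_mod_cast hNlt
    have h2 : 40 * (k : ℝ) ≤ n := by exact_mod_cast hn
    rw [div_div, div_le_iff₀ (by positivity)]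
    linarith
  calc ((n : ℝ) / k / 160) ^ m ≤ ((N : ℝ) / 4) ^ m := by gcongr
    _ = (N : ℝ) ^ m / 4 ^ m := div_pow _ _ _
    _ ≤ (N : ℝ) ^ m / 4 := by
        gcongr
        exact le_self_pow₀ (by norm_num) (by omega : m ≠ 0)
    _ ≤ P.width := hquarter

theorem rpow_le_of_pow_half_le {r q w : ℝ} {k : ℕ} (hk : 2 ≤ k) (hr : 1 ≤ r)
    (hq : r ^ (1 / 2 : ℝ) ≤ q) (hw : q ^ (k / 2) ≤ w) : r ^ (1 / 6 * (k : ℝ)) ≤ w := by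
  have hk' : (k : ℝ) ≤ 3 * (k / 2 : ℕ) := by exact_mod_cast (by omega : k ≤ 3 * (k / 2))
  calc r ^ (1 / 6 * (k : ℝ)) ≤ r ^ ((1 / 2 : ℝ) * (k / 2 : ℕ)) :=
        Real.rpow_le_rpow_of_exponent_le hr (by linarith)
    _ = (r ^ (1 / 2 : ℝ)) ^ (k / 2) := by
        rw [Real.rpow_mul (by linarith), Real.rpow_natCast]
    _ ≤ q ^ (k / 2) := by gcongr
    _ ≤ w := hw

/-- there are absolute constants `c > 0` and `C ≥ 1` such that for all
`k ≥ 2` and `n, U ≥ C·k`, any length-`n` ROBP over `[U]` computing `HeavyHitters[n,U,k]`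
has width at least `max {(n/k)^{c·k}, (U/k)^{c·k}}`. -/
theorem stmt18 :
    ∃ c C : ℝ, 0 < c ∧ 1 ≤ C ∧
      ∀ k n U : ℕ, 2 ≤ k → C * (k : ℝ) ≤ (n : ℝ) → C * (k : ℝ) ≤ (U : ℝ) →
        ∀ P : ROBP (Fin U) ((Fin k → Fin U) × (Fin k → ℝ)) n, P.Reachable →
          ComputesHeavyHitters n U k P →
          (P.width : ℝ) ≥
            max (((n : ℝ) / (k : ℝ)) ^ (c * (k : ℝ)))
              (((U : ℝ) / (k : ℝ)) ^ (c * (k : ℝ))) := by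
  refine ⟨1 / 6, 25600, by norm_num, by norm_num, fun k n U hk hn hU P _ h => ?_⟩
  have hk0 : (0 : ℝ) < k := by exact_mod_cast (by omega : 0 < k)
  have hn' : 25600 * k ≤ n := by exact_mod_cast hn
  have hU' : 25600 * k ≤ U := by exact_mod_cast hU
  have hr : 25600 ≤ (n : ℝ) / k := (le_div_iff₀ hk0).2 hn
  have hu : 25600 ≤ (U : ℝ) / k := (le_div_iff₀ hk0).2 hU
  refine max_le ?_ ?_
  · refine rpow_le_of_pow_half_le hk (by linarith) ?_
      (h.length_pow_le_width hk (by omega) (by omega))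
    rw [← Real.sqrt_eq_rpow, Real.sqrt_le_left (by positivity)]
    nlinarith
  · refine rpow_le_of_pow_half_le hk (by linarith) ?_
      (h.alphabet_pow_le_width hk (by omega) (by omega))
    rw [← Real.sqrt_eq_rpow, Real.sqrt_le_left (by positivity)]
    nlinarith
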